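/- There exists a constant C > 0, depending only on C₀ and the absolute Sobolev constant of ℝ³, with the following property. Let 0 < T ≤ 1, let u : ℝ³ × (0,T) → ℝ³ be smooth and divergence-free, and let ω : ℝ³ × (0,T) → ℝ³ be smooth and satisfy the vorticity equation ∂_s ω + (u·∇)ω = (ω·∇)u + Δω pointwise. Let x₀ ∈ ℝ³ and 0 < R with R² ≤ T, let ψ be a spatial cutoff at (x₀,R) with constant C₀ whose gradient/Laplacian bounds hold for both exponents ρ = 3/4 and ρ = 7/8, let η be a temporal cutoff on (0,T) with constant C₀ for both exponents ρ₁ = 3/4 and ρ₁ = 7/8, and set φ = ψη. Let t ∈ (2T/3, T) and put M := sup_{0<s<t} ∫_{B(x₀,2R)} |u(x,s)|² dx < ∞. Then | ∫₀ᵗ ∫ (ω·∇)u·ω φ dx ds − ∫ ½|ω(x,t)|² ψ(x) dx − ∫₀ᵗ ∫ |∇ω|² φ dx ds | ≤ (1/4) ∫₀ᵗ ∫ |∇ω|² φ dx ds + C max{M², 1} (1/R⁴) ∫₀ᵗ ∫ |ω|² φ^{1/2} dx ds. -/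

import Mathlib

noncomputable section
open MeasureTheory Real Set

local notation "ℝ³" => EuclideanSpace ℝ (Fin 3)

/-- `j`-th spatial partial derivative of a scalar function on `ℝ³`. -/
def pd (j : Fin 3) (f : ℝ³ → ℝ) (x : ℝ³) : ℝ :=
  fderiv ℝ f x (EuclideanSpace.single j 1)

/-- Laplacian of a scalar function on `ℝ³`. -/
def lap (f : ℝ³ → ℝ) (x : ℝ³) : ℝ := ∑ j : Fin 3, pd j (pd j f) x

/-- A spatial cutoff at `(x₀,R)` with exponent `ρ` and constant `C₀`. -/
def IsSpatialCutoff (x₀ : ℝ³) (R ρ C₀ : ℝ) (ψ : ℝ³ → ℝ) : Prop :=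
  ContDiff ℝ (⊤ : ℕ∞) ψ ∧
  (∀ x, 0 ≤ ψ x ∧ ψ x ≤ 1) ∧
  (∀ x ∈ Metric.ball x₀ R, ψ x = 1) ∧
  tsupport ψ ⊆ Metric.ball x₀ (2 * R) ∧
  (∀ x, ‖fderiv ℝ ψ x‖ ≤ C₀ / R * ψ x ^ ρ) ∧
  (∀ x, |lap ψ x| ≤ C₀ / R^2 * ψ x ^ (2 * ρ - 1))

/-- A temporal cutoff on `(0,T)` with exponent `ρ₁` and constant `C₀`. -/
def IsTemporalCutoff (T ρ₁ C₀ : ℝ) (η : ℝ → ℝ) : Prop :=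
  ContDiff ℝ (⊤ : ℕ∞) η ∧
  (∀ s, 0 ≤ η s ∧ η s ≤ 1) ∧
  (∀ s ∈ Set.Ioo (0:ℝ) (T/3), η s = 0) ∧
  (∀ s ∈ Set.Ioo (2*T/3) T, η s = 1) ∧
  (∀ s, |deriv η s| ≤ C₀ / T * η s ^ ρ₁)

/-- Joint (space-time) smoothness of a time-dependent vector field. -/
def SmoothVF (u : ℝ³ → ℝ → ℝ³) : Prop :=
  ContDiff ℝ (⊤ : ℕ∞) (fun q : ℝ³ × ℝ => u q.1 q.2)

/-- Pointwise incompressibility (divergence-free) on `ℝ³ × (0,T)`. -/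
def DivFree (T : ℝ) (u : ℝ³ → ℝ → ℝ³) : Prop :=
  ∀ x : ℝ³, ∀ t ∈ Set.Ioo (0:ℝ) T, ∑ j : Fin 3, pd j (fun y => u y t j) x = 0

/-- The vorticity equation `∂_s ω + (u·∇)ω = (ω·∇)u + Δω`, pointwise on `ℝ³ × (0,T)`. -/
def VorticityEq (T : ℝ) (u ω : ℝ³ → ℝ → ℝ³) : Prop :=
  ∀ x : ℝ³, ∀ t ∈ Set.Ioo (0:ℝ) T, ∀ i : Fin 3,
    deriv (fun s => ω x s i) t + ∑ j : Fin 3, u x t j * pd j (fun y => ω y t i) x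
      = ∑ j : Fin 3, ω x t j * pd j (fun y => u y t i) x
        + ∑ j : Fin 3, pd j (pd j (fun y => ω y t i)) x

/-- The vortex-stretching density `(ω·∇)u · ω = Σ_{i,j} ω_j ∂_j u_i ω_i`. -/
def vstDensity (u ω : ℝ³ → ℝ → ℝ³) (x : ℝ³) (s : ℝ) : ℝ :=
  ∑ i : Fin 3, ∑ j : Fin 3, ω x s j * pd j (fun y => u y s i) x * ω x s i

/-- `|∇ω|²`: the sum of squares of all first spatial partials of all components of `ω`. -/
def gradSq (ω : ℝ³ → ℝ → ℝ³) (x : ℝ³) (s : ℝ) : ℝ :=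
  ∑ i : Fin 3, ∑ j : Fin 3, (pd j (fun y => ω y s i) x)^2


/-- Young's inequality with exponents `4` and `4/3`, in polynomial form. -/
lemma le_add_div_of_pow_four_le {x P V ε : ℝ} (hP : 0 ≤ P) (hV : 0 ≤ V) (hε : 0 < ε)
    (h : x ^ 4 ≤ P * V ^ 3) : x ≤ ε * V + P / ε ^ 3 := by
  set Q := P / ε ^ 3 with hQ
  have hQ0 : 0 ≤ Q := by positivity
  have hPQ : P = Q * ε ^ 3 := by rw [hQ]; field_simp
  have hb : 0 ≤ ε * V := by positivity
  refine le_of_pow_le_pow_left₀ (n := 4) (by norm_num) (by positivity) (h.trans ?_)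
  have e : P * V ^ 3 = Q * (ε * V) ^ 3 := by rw [hPQ]; ring
  rw [e]
  generalize ε * V = b at *
  have : (b + Q) ^ 4 = Q * b ^ 3 + (b ^ 4 + 3 * (Q * b ^ 3) + 6 * (b ^ 2 * Q ^ 2)
    + 4 * (b * Q ^ 3) + Q ^ 4) := by ring
  rw [this]
  exact le_add_of_nonneg_right (by positivity)

/-- Cauchy–Schwarz for nonnegative square-integrable functions. -/
lemma integral_mul_le_sqrt_mul_sqrt {α : Type*} [MeasurableSpace α] {μ : Measure α}
    {f g : α → ℝ} (hf0 : ∀ x, 0 ≤ f x) (hg0 : ∀ x, 0 ≤ g x) (hf : MemLp f 2 μ)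
    (hg : MemLp g 2 μ) :
    ∫ x, f x * g x ∂μ ≤ √(∫ x, f x ^ 2 ∂μ) * √(∫ x, g x ^ 2 ∂μ) := by
  have h := integral_mul_le_Lp_mul_Lq_of_nonneg (μ := μ) (p := 2) (q := 2)
    Real.HolderConjugate.two_two (Filter.Eventually.of_forall hf0)
    (Filter.Eventually.of_forall hg0) (by simpa using hf) (by simpa using hg)
  simpa [Real.sqrt_eq_rpow] using h

/-- Gagliardo–Nirenberg–Sobolev inequality on `ℝ³` applied to the square of a nonnegative
function. -/
lemma exists_integral_cube_sq_le :
    ∃ S : ℝ, 0 ≤ S ∧ ∀ h : ℝ³ → ℝ, ContDiff ℝ 1 h → HasCompactSupport h → (∀ x, 0 ≤ h x) →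
      (∫ x, h x ^ 3) ^ 2 ≤ S * (∫ x, ‖fderiv ℝ (fun y => h y ^ 2) x‖) ^ 3 := by
  set C := lintegralPowLePowLIntegralFDerivConst (volume : Measure ℝ³) (3 / 2) with hC
  refine ⟨(C : ℝ) ^ 2, by positivity, fun h hh hs h0 => ?_⟩
  have hh2 : ContDiff ℝ 1 (fun y => h y ^ 2) := hh.pow 2
  have hs2 : HasCompactSupport (fun y => h y ^ 2) := by
    have := hs.mul_right (f' := h)
    convert! this using 2
    exact sq _
  have key := lintegral_pow_le_pow_lintegral_fderiv (volume : Measure ℝ³) hh2 hs2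
    (p := 3 / 2) (by
      rw [finrank_euclideanSpace_fin, Real.holderConjugate_iff]
      norm_num)
  rw [← hC] at key
  have hfc : Continuous (fderiv ℝ (fun y => h y ^ 2)) := hh2.continuous_fderiv (by norm_num)
  have hfi : Integrable (fderiv ℝ (fun y => h y ^ 2)) :=
    hfc.integrable_of_hasCompactSupport (hs2.fderiv ℝ)
  have e1 : ∀ x, ‖h x ^ 2‖ₑ ^ (3 / 2 : ℝ) = ENNReal.ofReal (h x ^ 3) := by
    intro x
    rw [Real.enorm_eq_ofReal (by positivity), ENNReal.ofReal_rpow_of_nonneg (by positivity)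
      (by norm_num), ← Real.rpow_natCast, ← Real.rpow_natCast, ← Real.rpow_mul (h0 x)]
    norm_num
  have hs3 : HasCompactSupport (fun y => h y ^ 3) := by
    have := hs2.mul_right (f' := h)
    convert! this using 2
  have hi3 : Integrable (fun y => h y ^ 3) :=
    (hh.continuous.pow 3).integrable_of_hasCompactSupport hs3
  have h30 : ∀ x, 0 ≤ h x ^ 3 := fun x => pow_nonneg (h0 x) 3
  simp only [e1] at key
  rw [← ofReal_integral_eq_lintegral_ofReal hi3 (Filter.Eventually.of_forall h30),
    ← ofReal_integral_norm_eq_lintegral_enorm hfi,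
    ENNReal.ofReal_rpow_of_nonneg (by positivity) (by norm_num),
    ← ENNReal.ofReal_coe_nnreal, ← ENNReal.ofReal_mul (by positivity),
    ENNReal.ofReal_le_ofReal_iff (by positivity)] at key
  have h3 : 0 ≤ ∫ x, h x ^ 3 := integral_nonneg h30
  set D := ∫ x, ‖fderiv ℝ (fun y => h y ^ 2) x‖
  have hD : 0 ≤ D := integral_nonneg fun x => norm_nonneg _
  calc (∫ x, h x ^ 3) ^ 2 ≤ (C * D ^ (3 / 2 : ℝ)) ^ 2 := by gcongr
    _ = (C : ℝ) ^ 2 * D ^ 3 := by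
      rw [mul_pow, ← Real.rpow_natCast (D ^ _), ← Real.rpow_mul hD, ← Real.rpow_natCast D 3]
      norm_num

/-- The algebra behind the absorption of the drift term. -/
lemma drift_absorption {A G Y I M L S : ℝ} (A0 : 0 ≤ A) (G0 : 0 ≤ G) (Y0 : 0 ≤ Y) (I0 : 0 ≤ I)
    (M0 : 0 ≤ M) (hL : 0 ≤ L) (hS : 0 ≤ S)
    (hsob : Y ^ 2 ≤ S * (√Y * (4 * √G + 2 * L * √A)) ^ 3) (hII : I ≤ √M * √(√Y * √A)) :
    (1 / 2) * L * I ≤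
      (1 / 4) * G + (L ^ 2 / 16 + 128 ^ 3 * (L / 2) ^ 4 * M ^ 2 * S ^ 2) * A := by
  have hg := Real.sq_sqrt G0
  have ha := Real.sq_sqrt A0
  have hm := Real.sq_sqrt M0
  have hyY := Real.sq_sqrt Y0
  have hya := Real.sq_sqrt (mul_nonneg (Real.sqrt_nonneg Y) (Real.sqrt_nonneg A))
  have y0 := Real.sqrt_nonneg Y
  have g0 := Real.sqrt_nonneg G
  have a0 := Real.sqrt_nonneg A
  generalize √(√Y * √A) = z at *
  generalize √Y = y at *
  generalize √M = m at *
  generalize √G = g at *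
  generalize √A = a at *
  have W0 : 0 ≤ 4 * g + 2 * L * a := by positivity
  have hW2 : (4 * g + 2 * L * a) ^ 2 ≤ 32 * G + 8 * L ^ 2 * A := by
    rw [← hg, ← ha]
    nlinarith [sq_nonneg (4 * g - 2 * L * a)]
  generalize 4 * g + 2 * L * a = W at *
  have hyW : y ≤ S * W ^ 3 := by
    rcases y0.eq_or_lt with h | h
    · rw [← h]; positivity
    · rw [← hyY] at hsob
      have h3 : 0 < y ^ 3 := by positivity
      refine le_of_mul_le_mul_left ?_ h3
      calc y ^ 3 * y = (y ^ 2) ^ 2 := by ring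
        _ ≤ _ := hsob
        _ = _ := by ring
  have hI4 : I ^ 4 ≤ M ^ 2 * (y ^ 2 * A) := by
    calc I ^ 4 ≤ (m * z) ^ 4 := by gcongr
      _ = (m ^ 2) ^ 2 * (z ^ 2) ^ 2 := by ring
      _ = M ^ 2 * (y ^ 2 * a ^ 2) := by rw [hm, hya]; ring
      _ = _ := by rw [ha]
  have hfin : ((1 / 2) * L * I) ^ 4 ≤
      ((L / 2) ^ 4 * M ^ 2 * S ^ 2 * A) * (32 * G + 8 * L ^ 2 * A) ^ 3 := by
    calc ((1 / 2) * L * I) ^ 4 = (L / 2) ^ 4 * I ^ 4 := by ring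
      _ ≤ (L / 2) ^ 4 * (M ^ 2 * (y ^ 2 * A)) := by gcongr
      _ ≤ (L / 2) ^ 4 * (M ^ 2 * ((S * W ^ 3) ^ 2 * A)) := by gcongr
      _ = ((L / 2) ^ 4 * M ^ 2 * S ^ 2 * A) * (W ^ 2) ^ 3 := by ring
      _ ≤ _ := by gcongr
  have := le_add_div_of_pow_four_le (ε := 1 / 128) (by positivity) (by positivity) (by norm_num)
    hfin
  refine this.trans (le_of_eq ?_)
  ring

/-- Interpolation and absorption for the drift term of a localized energy estimate. Here `n` plays
the role of `|ω|`, `p` of `|∇ω|`, and `q ^ 8` of the cutoff. -/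
lemma exists_drift_estimate :
    ∃ S : ℝ, 0 ≤ S ∧ ∀ (n p q : ℝ³ → ℝ) (v : ℝ³ → ℝ³) (x₀ : ℝ³) (r L M : ℝ),
      Continuous n → Continuous p → Continuous q → Continuous v →
      (∀ x, 0 ≤ n x) → (∀ x, 0 ≤ p x) → (∀ x, 0 ≤ q x) →
      ContDiff ℝ 1 (fun x => n x ^ 2) → ContDiff ℝ 1 (fun x => q x ^ 8) →
      (∀ x, ‖fderiv ℝ (fun y => n y ^ 2) x‖ ≤ 2 * n x * p x) →
      (∀ x, ‖fderiv ℝ (fun y => q y ^ 8) x‖ ≤ L * q x ^ 6) → 0 ≤ L →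
      tsupport q ⊆ Metric.ball x₀ r → ∫ x in Metric.ball x₀ r, ‖v x‖ ^ 2 ≤ M →
      (1 / 2) * L * ∫ x, n x ^ 2 * ‖v x‖ * q x ^ 7 ≤
        (1 / 4) * (∫ x, p x ^ 2 * q x ^ 8)
          + (L ^ 2 / 16 + 128 ^ 3 * (L / 2) ^ 4 * M ^ 2 * S) * ∫ x, n x ^ 2 * q x ^ 4 := by
  obtain ⟨S, hS, hSob⟩ := exists_integral_cube_sq_le
  refine ⟨S ^ 2, by positivity, ?_⟩
  intro n p q v x₀ r L M hn hp hq hv n0 p0 q0 hn1 hq1 hdn hdq hL hsupp hM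
  have hcs : HasCompactSupport q :=
    (isCompact_closedBall x₀ r).of_isClosed_subset (isClosed_tsupport q)
      (hsupp.trans Metric.ball_subset_closedBall)
  have hcpow : ∀ (k : ℕ) (f : ℝ³ → ℝ), k ≠ 0 → HasCompactSupport (fun x => f x * q x ^ k) := by
    intro k f hk
    refine hcs.mono fun x hx => ?_
    simp only [Function.mem_support] at hx ⊢
    intro h
    apply hx
    simp [h, hk]
  have hmem : ∀ (k : ℕ) (f : ℝ³ → ℝ), k ≠ 0 → Continuous f →
      MemLp (fun x => f x * q x ^ k) 2 volume := fun k f hk hf =>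
    (hf.mul (hq.pow k)).memLp_of_hasCompactSupport (hcpow k f hk)
  have hInt : ∀ (k : ℕ) (f : ℝ³ → ℝ), k ≠ 0 → Continuous f →
      Integrable (fun x => f x * q x ^ k) volume := fun k f hk hf =>
    (hf.mul (hq.pow k)).integrable_of_hasCompactSupport (hcpow k f hk)
  set A := ∫ x, n x ^ 2 * q x ^ 4 with hA
  set G := ∫ x, p x ^ 2 * q x ^ 8 with hG
  set Y := ∫ x, n x ^ 6 * q x ^ 24 with hY
  set I := ∫ x, n x ^ 2 * ‖v x‖ * q x ^ 7 with hI
  have A0 : 0 ≤ A := integral_nonneg fun x => by have := n0 x; have := q0 x; positivity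
  have G0 : 0 ≤ G := integral_nonneg fun x => by have := p0 x; have := q0 x; positivity
  have Y0 : 0 ≤ Y := integral_nonneg fun x => by have := n0 x; have := q0 x; positivity
  have I0 : 0 ≤ I := integral_nonneg fun x => by have := n0 x; have := q0 x; positivity
  have M0 : 0 ≤ M := le_trans (integral_nonneg fun x => by positivity) hM
  have hY' : ∫ x, (n x ^ 3 * q x ^ 12) ^ 2 = Y := by
    rw [hY]; congr 1; ext x; ring
  have hA' : ∫ x, (n x * q x ^ 2) ^ 2 = A := by
    rw [hA]; congr 1; ext x; ring
  have hG' : ∫ x, (p x * q x ^ 4) ^ 2 = G := by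
    rw [hG]; congr 1; ext x; ring
  have m1 := hmem 12 (fun x => n x ^ 3) (by norm_num) (hn.pow 3)
  have m2 := hmem 2 n (by norm_num) hn
  have m3 := hmem 4 p (by norm_num) hp
  have cs1 : ∫ x, (n x ^ 3 * q x ^ 12) * (p x * q x ^ 4) ≤ √Y * √G := by
    rw [← hY', ← hG']
    exact integral_mul_le_sqrt_mul_sqrt
      (fun x => by have := n0 x; have := q0 x; positivity)
      (fun x => by have := p0 x; have := q0 x; positivity) m1 m3
  have cs2 : ∫ x, (n x ^ 3 * q x ^ 12) * (n x * q x ^ 2) ≤ √Y * √A := by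
    rw [← hY', ← hA']
    exact integral_mul_le_sqrt_mul_sqrt
      (fun x => by have := n0 x; have := q0 x; positivity)
      (fun x => by have := n0 x; have := q0 x; positivity) m1 m2
  have i1 : Integrable (fun x => (n x ^ 3 * q x ^ 12) * (p x * q x ^ 4)) := by
    have := hInt 16 (fun x => n x ^ 3 * p x) (by norm_num) (by fun_prop)
    refine this.congr (Filter.Eventually.of_forall fun x => ?_)
    simp only; ring
  have i2 : Integrable (fun x => (n x ^ 3 * q x ^ 12) * (n x * q x ^ 2)) := by
    have := hInt 14 (fun x => n x ^ 4) (by norm_num) (by fun_prop)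
    refine this.congr (Filter.Eventually.of_forall fun x => ?_)
    simp only; ring
  set W := 4 * √G + 2 * L * √A with hW
  have W0 : 0 ≤ W := by positivity
  set y := √Y
  have y0 : 0 ≤ y := Real.sqrt_nonneg _
  have hsob : Y ^ 2 ≤ S * (y * W) ^ 3 := by
    have hh := hSob (fun x => n x ^ 2 * q x ^ 8) (hn1.mul hq1)
      (hcpow 8 (fun x => n x ^ 2) (by norm_num))
      (fun x => by have := n0 x; have := q0 x; positivity)
    have e : ∫ x, (n x ^ 2 * q x ^ 8) ^ 3 = Y := by
      rw [hY]; congr 1; ext x; ring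
    rw [e] at hh
    refine hh.trans ?_
    have hpt : ∀ x, ‖fderiv ℝ (fun y => (n y ^ 2 * q y ^ 8) ^ 2) x‖ ≤
        4 * ((n x ^ 3 * q x ^ 12) * (p x * q x ^ 4))
          + 2 * L * ((n x ^ 3 * q x ^ 12) * (n x * q x ^ 2)) := by
      intro x
      have d1 := (hn1.differentiable (by norm_num) x).hasFDerivAt
      have d2 := (hq1.differentiable (by norm_num) x).hasFDerivAt
      have d3 := ((d1.mul d2).pow 2).fderiv
      have hn' := n0 x
      have hq' := q0 x
      have hp' := p0 x
      have d4 : fderiv ℝ (fun y => (n y ^ 2 * q y ^ 8) ^ 2) x =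
          (2 * (n x ^ 2 * q x ^ 8)) • (n x ^ 2 • fderiv ℝ (fun y => q y ^ 8) x
            + q x ^ 8 • fderiv ℝ (fun y => n y ^ 2) x) := by
        refine d3.trans ?_
        simp
      rw [d4, norm_smul, Real.norm_of_nonneg (by positivity)]
      calc _ ≤ 2 * (n x ^ 2 * q x ^ 8) * (n x ^ 2 * (L * q x ^ 6)
            + q x ^ 8 * (2 * n x * p x)) := by
            gcongr
            refine (norm_add_le _ _).trans ?_
            rw [norm_smul, norm_smul, Real.norm_of_nonneg (by positivity),
              Real.norm_of_nonneg (by positivity)]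
            gcongr
            · exact hdq x
            · exact hdn x
        _ = _ := by ring
    have : ∫ x, ‖fderiv ℝ (fun y => (n y ^ 2 * q y ^ 8) ^ 2) x‖ ≤ y * W := by
      calc _ ≤ ∫ x, (4 * ((n x ^ 3 * q x ^ 12) * (p x * q x ^ 4))
          + 2 * L * ((n x ^ 3 * q x ^ 12) * (n x * q x ^ 2))) :=
            integral_mono_of_nonneg (Filter.Eventually.of_forall fun x => norm_nonneg _)
              ((i1.const_mul 4).add (i2.const_mul (2 * L))) (Filter.Eventually.of_forall hpt)
        _ = 4 * (∫ x, (n x ^ 3 * q x ^ 12) * (p x * q x ^ 4))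
          + 2 * L * ∫ x, (n x ^ 3 * q x ^ 12) * (n x * q x ^ 2) := by
            rw [integral_add (i1.const_mul 4) (i2.const_mul (2 * L)), integral_const_mul,
              integral_const_mul]
        _ ≤ 4 * (y * √G) + 2 * L * (y * √A) := by gcongr
        _ = y * W := by rw [hW]; ring
    gcongr
  have hII : I ≤ √M * √(√Y * √A) := by
    have e : I = ∫ x in Metric.ball x₀ r, ‖v x‖ * (n x ^ 2 * q x ^ 7) := by
      rw [setIntegral_eq_integral_of_forall_compl_eq_zero]
      · rw [hI]; congr 1; ext x; ring
      · intro x hx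
        have : q x = 0 := image_eq_zero_of_notMem_tsupport fun h => hx (hsupp h)
        simp [this]
    have hvm : MemLp (fun x => ‖v x‖) 2 (volume.restrict (Metric.ball x₀ r)) := by
      rw [memLp_two_iff_integrable_sq hv.norm.aestronglyMeasurable]
      exact ((hv.norm.pow 2).continuousOn.integrableOn_compact
        (isCompact_closedBall x₀ r)).mono_set Metric.ball_subset_closedBall
    have hqm := (hmem 7 (fun x => n x ^ 2) (by norm_num) (hn.pow 2)).restrict (Metric.ball x₀ r)
    rw [e]
    refine (integral_mul_le_sqrt_mul_sqrt (fun x => norm_nonneg _)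
      (fun x => by have := n0 x; have := q0 x; positivity) hvm hqm).trans ?_
    gcongr
    refine le_trans ?_ cs2
    rw [setIntegral_eq_integral_of_forall_compl_eq_zero]
    · apply le_of_eq; congr 1; ext x; ring
    · intro x hx
      have : q x = 0 := image_eq_zero_of_notMem_tsupport fun h => hx (hsupp h)
      simp [this]
  exact drift_absorption A0 G0 Y0 I0 M0 hL hS hsob hII

lemma pd_add {j : Fin 3} {f g : ℝ³ → ℝ} {x : ℝ³} (hf : DifferentiableAt ℝ f x)
    (hg : DifferentiableAt ℝ g x) : pd j (fun y => f y + g y) x = pd j f x + pd j g x := by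
  simp only [pd]
  rw [fderiv_fun_add hf hg]
  rfl

lemma pd_sub {j : Fin 3} {f g : ℝ³ → ℝ} {x : ℝ³} (hf : DifferentiableAt ℝ f x)
    (hg : DifferentiableAt ℝ g x) : pd j (fun y => f y - g y) x = pd j f x - pd j g x := by
  simp only [pd]
  rw [fderiv_fun_sub hf hg]
  rfl

lemma pd_mul {j : Fin 3} {f g : ℝ³ → ℝ} {x : ℝ³} (hf : DifferentiableAt ℝ f x)
    (hg : DifferentiableAt ℝ g x) :
    pd j (fun y => f y * g y) x = pd j f x * g x + f x * pd j g x := by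
  simp only [pd]
  rw [fderiv_fun_mul hf hg]
  simp
  ring

lemma pd_const_mul {j : Fin 3} {f : ℝ³ → ℝ} {x : ℝ³} (c : ℝ) (hf : DifferentiableAt ℝ f x) :
    pd j (fun y => c * f y) x = c * pd j f x := by
  simp only [pd]
  rw [fderiv_const_mul hf]
  simp

lemma ContDiff.pd {f : ℝ³ → ℝ} (hf : ContDiff ℝ (⊤ : ℕ∞) f) (j : Fin 3) :
    ContDiff ℝ (⊤ : ℕ∞) (pd j f) := by
  have h : ContDiff ℝ (⊤ : ℕ∞) (fderiv ℝ f) := hf.fderiv_right (by simp)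
  exact h.clm_apply contDiff_const

lemma HasCompactSupport.pd {f : ℝ³ → ℝ} (hf : HasCompactSupport f) (j : Fin 3) :
    HasCompactSupport (pd j f) :=
  hf.fderiv_apply ℝ _

lemma integral_pd_eq_zero {f : ℝ³ → ℝ} (hf : ContDiff ℝ (⊤ : ℕ∞) f) (hs : HasCompactSupport f)
    (j : Fin 3) : ∫ x, pd j f x = 0 := by
  have hi : Integrable (_root_.pd j f) :=
    (hf.pd j).continuous.integrable_of_hasCompactSupport (hs.pd j)
  have hi0 : Integrable f := hf.continuous.integrable_of_hasCompactSupport hs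
  have := integral_mul_fderiv_eq_neg_fderiv_mul_of_integrable (μ := (volume : Measure ℝ³))
    (f := fun _ : ℝ³ => (1 : ℝ)) (g := f) (v := EuclideanSpace.single j 1) (by simp)
    (by simp only [one_mul]; exact hi) (by simpa using hi0) (fun x _ => by fun_prop)
    (fun x _ => (hf.differentiable (by simp)) x)
  simpa [_root_.pd] using this

lemma sum_mul_pd_eq_fderiv (v : ℝ³) (f : ℝ³ → ℝ) (x : ℝ³) :
    ∑ j, v j * pd j f x = fderiv ℝ f x v := by
  have hv : v = ∑ j, v j • EuclideanSpace.single j (1 : ℝ) := by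
    ext k
    simp [Finset.sum_apply, Pi.single_apply]
  conv_rhs => rw [hv]
  simp [pd]

/-- The localized energy identity for one scalar component advected by a divergence-free field. -/
lemma integral_energy_identity {f ψ : ℝ³ → ℝ} {U : Fin 3 → ℝ³ → ℝ}
    (hf : ContDiff ℝ (⊤ : ℕ∞) f) (hψ : ContDiff ℝ (⊤ : ℕ∞) ψ) (hψs : HasCompactSupport ψ)
    (hU : ∀ j, ContDiff ℝ (⊤ : ℕ∞) (U j)) (hdiv : ∀ x, ∑ j, pd j (U j) x = 0) :
    Integrable (fun x => (∑ j, U j x * pd j f x - ∑ j, pd j (pd j f) x) * f x * ψ x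
      - (∑ j, pd j f x ^ 2) * ψ x + (1 / 2) * f x ^ 2 * (∑ j, U j x * pd j ψ x + lap ψ x)) ∧
    ∫ x, ((∑ j, U j x * pd j f x - ∑ j, pd j (pd j f) x) * f x * ψ x
      - (∑ j, pd j f x ^ 2) * ψ x + (1 / 2) * f x ^ 2 * (∑ j, U j x * pd j ψ x + lap ψ x)) = 0 := by
  let F : Fin 3 → ℝ³ → ℝ := fun j y =>
    (1 / 2) * (U j y * ((f y * f y) * ψ y)) - (f y * pd j f y) * ψ y
      + (1 / 2) * ((f y * f y) * pd j ψ y)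
  have hF : ∀ j, ContDiff ℝ (⊤ : ℕ∞) (F j) := by
    intro j
    have h1 := hU j
    have h2 := hf.pd j
    have h3 := hψ.pd j
    exact ((contDiff_const.mul (h1.mul ((hf.mul hf).mul hψ))).sub ((hf.mul h2).mul hψ)).add
      (contDiff_const.mul ((hf.mul hf).mul h3))
  have hFs : ∀ j, HasCompactSupport (F j) := by
    intro j
    have h3 := hψs.pd j
    exact (hψs.mul_left.mul_left.mul_left.sub hψs.mul_left).add (h3.mul_left.mul_left)
  have hpt : ∀ x, (∑ j, U j x * pd j f x - ∑ j, pd j (pd j f) x) * f x * ψ x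
      - (∑ j, pd j f x ^ 2) * ψ x + (1 / 2) * f x ^ 2 * (∑ j, U j x * pd j ψ x + lap ψ x)
      = ∑ j, pd j (F j) x := by
    intro x
    have df : Differentiable ℝ f := hf.differentiable (by simp)
    have dψ : Differentiable ℝ ψ := hψ.differentiable (by simp)
    have dU : ∀ j, Differentiable ℝ (U j) := fun j => (hU j).differentiable (by simp)
    have dpf : ∀ j, Differentiable ℝ (pd j f) := fun j => (hf.pd j).differentiable (by simp)
    have dpψ : ∀ j, Differentiable ℝ (pd j ψ) := fun j => (hψ.pd j).differentiable (by simp)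
    have hj : ∀ j, pd j (F j) x = (1 / 2) * f x ^ 2 * ψ x * pd j (U j) x
        + U j x * pd j f x * f x * ψ x + (1 / 2) * f x ^ 2 * (U j x * pd j ψ x)
        - pd j f x ^ 2 * ψ x - pd j (pd j f) x * f x * ψ x
        + (1 / 2) * f x ^ 2 * pd j (pd j ψ) x := by
      intro j
      have a1 := df x
      have a2 := dψ x
      have a3 := dU j x
      have a4 := dpf j x
      have a5 := dpψ j x
      have b1 := a1.fun_mul a1
      have b2 := b1.fun_mul a2
      have b3 := a3.fun_mul b2
      have b4 := a1.fun_mul a4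
      have b5 := b4.fun_mul a2
      have b6 := b1.fun_mul a5
      have e := pd_add (j := j) ((b3.const_mul (1 / 2)).fun_sub b5) (b6.const_mul (1 / 2))
      refine e.trans ?_
      rw [pd_sub (b3.const_mul (1 / 2)) b5, pd_const_mul _ b3, pd_const_mul _ b6, pd_mul a3 b2,
        pd_mul b1 a2, pd_mul b4 a2, pd_mul a1 a4, pd_mul b1 a5, pd_mul a1 a1]
      ring
    have hd := hdiv x
    simp only [hj, lap, Fin.sum_univ_three] at hd ⊢
    linear_combination (-(1 / 2) * f x ^ 2 * ψ x) * hd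
  have hi : ∀ j, Integrable (pd j (F j)) := fun j =>
    ((hF j).pd j).continuous.integrable_of_hasCompactSupport ((hFs j).pd j)
  constructor
  · exact (integrable_finsetSum _ fun j _ => hi j).congr
      (Filter.Eventually.of_forall fun x => (hpt x).symm)
  · simp only [hpt]
    rw [integral_finsetSum _ fun j _ => hi j]
    exact Finset.sum_eq_zero fun j _ => integral_pd_eq_zero (hF j) (hFs j) j

/-- The derivative of `|w|²` is controlled by `2 |w| |∇w|`. -/
lemma norm_fderiv_norm_sq_le {w : ℝ³ → ℝ³} (hw : ∀ i, Differentiable ℝ fun y => w y i) (x : ℝ³) :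
    ‖fderiv ℝ (fun y => ‖w y‖ ^ 2) x‖ ≤
      2 * ‖w x‖ * √(∑ i : Fin 3, ∑ j : Fin 3, pd j (fun y => w y i) x ^ 2) := by
  refine ContinuousLinearMap.opNorm_le_bound _ (by positivity) fun v => ?_
  have e : (fun y => ‖w y‖ ^ 2) = fun y => ∑ i, w y i ^ 2 := by
    ext y; rw [EuclideanSpace.real_norm_sq_eq]
  have d : fderiv ℝ (fun y => ‖w y‖ ^ 2) x v =
      2 * ∑ i, w x i * ∑ j, v j * pd j (fun y => w y i) x := by
    rw [e, fderiv_fun_sum fun i _ => ((hw i) x).fun_pow 2]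
    simp only [sum_mul_pd_eq_fderiv]
    rw [Finset.mul_sum, sum_apply]
    refine Finset.sum_congr rfl fun i _ => ?_
    rw [fderiv_fun_pow 2 (hw i x)]
    simp
    ring
  rw [d, Real.norm_eq_abs, abs_mul, abs_two, mul_assoc, mul_assoc]
  gcongr
  refine abs_le_of_sq_le_sq ?_ (by positivity)
  rw [mul_pow, mul_pow, Real.sq_sqrt (by positivity), EuclideanSpace.real_norm_sq_eq,
    EuclideanSpace.real_norm_sq_eq]
  calc _ ≤ (∑ i, w x i ^ 2) * ∑ i, (∑ j, v j * pd j (fun y => w y i) x) ^ 2 :=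
        Finset.sum_mul_sq_le_sq_mul_sq _ _ _
    _ ≤ (∑ i, w x i ^ 2) * ∑ i, (∑ j, v j ^ 2) * ∑ j, pd j (fun y => w y i) x ^ 2 := by
        gcongr with i
        exact Finset.sum_mul_sq_le_sq_mul_sq _ _ _
    _ = _ := by
        rw [← Finset.mul_sum]
        ring

/-- Integrals against a compactly supported weight depend continuously on parameters. -/
lemma continuous_integral_mul_cutoff {F : ℝ³ → ℝ → ℝ} {ψ : ℝ³ → ℝ}
    (hF : Continuous fun q : ℝ³ × ℝ => F q.1 q.2) (hψ : Continuous ψ) (hψs : HasCompactSupport ψ) :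
    Continuous fun s => ∫ x, F x s * ψ x := by
  have h : Continuous (Function.uncurry fun (s : ℝ) (x : ℝ³) => F x s * ψ x) := by
    have := hF.comp (continuous_snd.prodMk continuous_fst : Continuous fun q : ℝ × ℝ³ => (q.2, q.1))
    exact this.mul (hψ.comp continuous_snd)
  convert! continuous_parametric_integral_of_continuous (μ := volume) h hψs using 2 with s
  rw [setIntegral_eq_integral_of_forall_compl_eq_zero]
  intro x hx
  simp [image_eq_zero_of_notMem_tsupport hx]

lemma hasDerivAt_integral_mul_cutoff {F F' : ℝ³ → ℝ → ℝ} {ψ : ℝ³ → ℝ}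
    (hF : Continuous fun q : ℝ³ × ℝ => F q.1 q.2) (hF' : Continuous fun q : ℝ³ × ℝ => F' q.1 q.2)
    (hd : ∀ x s, HasDerivAt (F x) (F' x s) s) (hψ : Continuous ψ) (hψs : HasCompactSupport ψ)
    (s : ℝ) : HasDerivAt (fun s => ∫ x, F x s * ψ x) (∫ x, F' x s * ψ x) s := by
  have sl : ∀ {H : ℝ³ → ℝ → ℝ}, (Continuous fun q : ℝ³ × ℝ => H q.1 q.2) → ∀ r : ℝ,
      Continuous fun x => H x r * ψ x := fun hH r =>
    (hH.comp (continuous_id.prodMk continuous_const : Continuous fun x : ℝ³ => (x, r))).mul hψ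
  obtain ⟨B, hB⟩ :=
    (hψs.prod (isCompact_Icc (a := s - 1) (b := s + 1))).exists_bound_of_continuousOn
    hF'.continuousOn
  refine (hasDerivAt_integral_of_dominated_loc_of_deriv_le (μ := (volume : Measure ℝ³))
    (F := fun s x => F x s * ψ x) (F' := fun s x => F' x s * ψ x)
    (bound := fun x => B * ‖ψ x‖) (Icc_mem_nhds (by linarith : s - 1 < s) (by linarith : s < s + 1))
    (Filter.Eventually.of_forall fun r => (sl hF r).aestronglyMeasurable)
    ((sl hF s).integrable_of_hasCompactSupport hψs.mul_left)
    (sl hF' s).aestronglyMeasurable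
    (Filter.Eventually.of_forall fun x r hr => ?_)
    ((hψ.integrable_of_hasCompactSupport hψs).norm.const_mul B)
    (Filter.Eventually.of_forall fun x r _ => (hd x r).mul_const (ψ x))).2
  rw [norm_mul]
  by_cases hx : x ∈ tsupport ψ
  · gcongr
    exact hB (x, r) ⟨hx, hr⟩
  · simp [image_eq_zero_of_notMem_tsupport hx]

lemma IsSpatialCutoff.hasCompactSupport {x₀ : ℝ³} {R ρ C₀ : ℝ} {ψ : ℝ³ → ℝ}
    (h : IsSpatialCutoff x₀ R ρ C₀ ψ) : HasCompactSupport ψ :=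
  (isCompact_closedBall x₀ (2 * R)).of_isClosed_subset (isClosed_tsupport ψ)
    (h.2.2.2.1.trans Metric.ball_subset_closedBall)

/-- The flux through the cutoff of the localized enstrophy is absorbed by the dissipation and the
localized enstrophy. -/
lemma exists_cutoff_flux_estimate :
    ∃ S : ℝ, 0 ≤ S ∧ ∀ (C₀ R M : ℝ) (x₀ : ℝ³) (w v : ℝ³ → ℝ³) (ψ : ℝ³ → ℝ), 0 < C₀ → 0 < R →
      (∀ i, ContDiff ℝ (⊤ : ℕ∞) fun y => w y i) → Continuous v →
      IsSpatialCutoff x₀ R (3 / 4) C₀ ψ → IsSpatialCutoff x₀ R (7 / 8) C₀ ψ →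
      ∫ x in Metric.ball x₀ (2 * R), ‖v x‖ ^ 2 ≤ M →
      |∫ x, (1 / 2) * ‖w x‖ ^ 2 * (∑ j, v x j * pd j ψ x + lap ψ x)| ≤
        (1 / 4) * (∫ x, (∑ i : Fin 3, ∑ j : Fin 3, pd j (fun y => w y i) x ^ 2) * ψ x)
          + ((C₀ / R) ^ 2 / 16 + 128 ^ 3 * (C₀ / R / 2) ^ 4 * M ^ 2 * S + C₀ / R ^ 2 / 2)
            * ∫ x, ‖w x‖ ^ 2 * ψ x ^ ((1 : ℝ) / 2) := by
  obtain ⟨S, hS, hdrift⟩ := exists_drift_estimate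
  refine ⟨S, hS, ?_⟩
  intro C₀ R M x₀ w v ψ hC₀ hR hw hv h34 h78 hM
  have hcs := h34.hasCompactSupport
  obtain ⟨hψ, hψ01, -, hsupp, hgrad34, hlap⟩ := h34
  obtain ⟨-, -, -, -, hgrad78, -⟩ := h78
  set p : ℝ³ → ℝ := fun x => √(∑ i : Fin 3, ∑ j : Fin 3, pd j (fun y => w y i) x ^ 2)
  set q : ℝ³ → ℝ := fun x => ψ x ^ ((1 : ℝ) / 8) with hq
  have hpow : ∀ (k : ℕ) x, q x ^ k = ψ x ^ ((k : ℝ) / 8) := by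
    intro k x
    rw [hq, ← Real.rpow_natCast, ← Real.rpow_mul (hψ01 x).1]
    congr 1
    ring
  have q8 : ∀ x, q x ^ 8 = ψ x := fun x => by rw [hpow]; norm_num
  have q7 : ∀ x, ψ x ^ ((7 : ℝ) / 8) = q x ^ 7 := fun x => by rw [hpow]; norm_num
  have q6 : ∀ x, ψ x ^ ((3 : ℝ) / 4) = q x ^ 6 := fun x => by rw [hpow]; norm_num
  have q4 : ∀ x, ψ x ^ ((1 : ℝ) / 2) = q x ^ 4 := fun x => by rw [hpow]; norm_num
  have q8' : (fun x => q x ^ 8) = ψ := funext q8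
  have q0 : ∀ x, 0 ≤ q x := fun x => Real.rpow_nonneg (hψ01 x).1 _
  have hqc : Continuous q := hψ.continuous.rpow_const fun x => Or.inr (by norm_num)
  have hwc : Continuous w := (PiLp.continuous_toLp 2 _).comp
    (continuous_pi fun i => (hw i).continuous)
  have hpc : Continuous p := by
    refine (continuous_finsetSum _ fun i _ => continuous_finsetSum _ fun j _ => ?_).sqrt
    exact ((hw i).pd j).continuous.pow 2
  have hn2 : ContDiff ℝ 1 (fun x => ‖w x‖ ^ 2) := by
    simp only [EuclideanSpace.real_norm_sq_eq]
    exact ContDiff.sum fun i _ => ((hw i).of_le (by simp)).pow 2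
  have hqs : tsupport q ⊆ tsupport ψ := by
    refine closure_mono fun x hx => ?_
    simp only [Function.mem_support, hq] at hx ⊢
    intro h
    exact hx (by rw [h]; norm_num)
  have hqcs : HasCompactSupport q := hcs.of_isClosed_subset (isClosed_tsupport q) hqs
  have main := hdrift (fun x => ‖w x‖) p q v x₀ (2 * R) (C₀ / R) M hwc.norm hpc hqc hv
    (fun x => norm_nonneg _) (fun x => Real.sqrt_nonneg _) q0 hn2
    (by rw [q8']; exact hψ.of_le (by simp))
    (norm_fderiv_norm_sq_le fun i => (hw i).differentiable (by simp))
    (fun x => by rw [q8', ← q6]; exact hgrad34 x) (by positivity) (hqs.trans hsupp) hM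
  have p2 : ∀ x, p x ^ 2 = ∑ i : Fin 3, ∑ j : Fin 3, pd j (fun y => w y i) x ^ 2 :=
    fun x => Real.sq_sqrt (by positivity)
  simp only [p2, q8] at main
  simp only [q4]
  have hi : ∀ (k : ℕ) (f : ℝ³ → ℝ), k ≠ 0 → Continuous f →
      Integrable (fun x => f x * q x ^ k) volume := fun k f hk hf =>
    (hf.mul (hqc.pow k)).integrable_of_hasCompactSupport (hqcs.mono fun x hx => by
      simp only [Function.mem_support] at hx ⊢
      intro h
      exact hx (by simp [h, hk]))
  have i7 := hi 7 (fun x => ‖w x‖ ^ 2 * ‖v x‖) (by norm_num) (by fun_prop)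
  have i4 := hi 4 (fun x => ‖w x‖ ^ 2) (by norm_num) (by fun_prop)
  have hbound : |∫ x, (1 / 2) * ‖w x‖ ^ 2 * (∑ j, v x j * pd j ψ x + lap ψ x)| ≤
      (1 / 2) * (C₀ / R) * (∫ x, ‖w x‖ ^ 2 * ‖v x‖ * q x ^ 7)
        + C₀ / R ^ 2 / 2 * ∫ x, ‖w x‖ ^ 2 * q x ^ 4 := by
    rw [← integral_const_mul, ← integral_const_mul,
      ← integral_add (i7.const_mul _) (i4.const_mul _), ← Real.norm_eq_abs]
    refine norm_integral_le_of_norm_le ((i7.const_mul _).add (i4.const_mul _))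
      (Filter.Eventually.of_forall fun x => ?_)
    have hd : |∑ j, v x j * pd j ψ x| ≤ C₀ / R * q x ^ 7 * ‖v x‖ := by
      rw [sum_mul_pd_eq_fderiv, ← Real.norm_eq_abs]
      refine ((fderiv ℝ ψ x).le_opNorm _).trans ?_
      gcongr
      rw [← q7]
      exact hgrad78 x
    have hl : |lap ψ x| ≤ C₀ / R ^ 2 * q x ^ 4 := by
      refine (hlap x).trans (le_of_eq ?_)
      rw [← q4]
      norm_num
    rw [norm_mul, Real.norm_of_nonneg (by positivity), Real.norm_eq_abs]
    calc _ ≤ 1 / 2 * ‖w x‖ ^ 2 * (C₀ / R * q x ^ 7 * ‖v x‖ + C₀ / R ^ 2 * q x ^ 4) := by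
          gcongr
          exact (abs_add_le _ _).trans (add_le_add hd hl)
      _ = _ := by ring
  calc _ ≤ _ := hbound
    _ ≤ _ := add_le_add_left main _
    _ = _ := by ring

section SpaceTime

variable {g : ℝ³ × ℝ → ℝ}

lemma contDiff_slice (hg : ContDiff ℝ (⊤ : ℕ∞) g) (s : ℝ) :
    ContDiff ℝ (⊤ : ℕ∞) fun y => g (y, s) :=
  hg.comp (contDiff_id.prodMk contDiff_const)

lemma continuous_pd_slice (hg : ContDiff ℝ (⊤ : ℕ∞) g) (j : Fin 3) :
    Continuous fun z : ℝ³ × ℝ => pd j (fun y => g (y, z.2)) z.1 := by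
  have h : ∀ z : ℝ³ × ℝ, pd j (fun y => g (y, z.2)) z.1 =
      fderiv ℝ g z (EuclideanSpace.single j 1, 0) := by
    intro z
    have h1 : HasFDerivAt g (fderiv ℝ g z) (z.1, z.2) :=
      (hg.differentiable (by simp) z).hasFDerivAt
    have h2 := HasFDerivAt.comp (f := fun y => (y, z.2)) z.1 h1 (hasFDerivAt_prodMk_left z.1 z.2)
    rw [pd]
    have h3 : fderiv ℝ (fun y => g (y, z.2)) z.1 = _ := h2.fderiv
    rw [h3]
    simp
  simp only [h]
  exact (hg.continuous_fderiv (by simp)).clm_apply continuous_const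

lemma hasDerivAt_slice (hg : ContDiff ℝ (⊤ : ℕ∞) g) (x : ℝ³) (s : ℝ) :
    HasDerivAt (fun r => g (x, r)) (deriv (fun r => g (x, r)) s) s :=
  ((hg.comp (contDiff_const.prodMk contDiff_id) :
    ContDiff ℝ (⊤ : ℕ∞) fun r : ℝ => g (x, r)).differentiable (by simp) s).hasDerivAt

lemma continuous_deriv_slice (hg : ContDiff ℝ (⊤ : ℕ∞) g) :
    Continuous fun z : ℝ³ × ℝ => deriv (fun r => g (z.1, r)) z.2 := by
  have h : ∀ z : ℝ³ × ℝ, deriv (fun r => g (z.1, r)) z.2 = fderiv ℝ g z (0, 1) := by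
    intro z
    have h1 : HasFDerivAt g (fderiv ℝ g z) (z.1, z.2) :=
      (hg.differentiable (by simp) z).hasFDerivAt
    have h2 := (HasFDerivAt.comp (f := fun r => (z.1, r)) z.2 h1
      (hasFDerivAt_prodMk_right z.1 z.2)).hasDerivAt.deriv
    refine Eq.trans h2 ?_
    simp
  simp only [h]
  exact (hg.continuous_fderiv (by simp)).clm_apply continuous_const

end SpaceTime

lemma SmoothVF.comp_apply {u : ℝ³ → ℝ → ℝ³} (hu : SmoothVF u) (i : Fin 3) :
    ContDiff ℝ (⊤ : ℕ∞) fun z : ℝ³ × ℝ => u z.1 z.2 i :=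
  contDiff_euclidean.1 hu i

/-- The localized enstrophy balance at a fixed time. -/
lemma integral_vstDensity_eq {T : ℝ} {u ω : ℝ³ → ℝ → ℝ³} {ψ : ℝ³ → ℝ} (hu : SmoothVF u)
    (hdiv : DivFree T u) (hω : SmoothVF ω) (heq : VorticityEq T u ω)
    (hψ : ContDiff ℝ (⊤ : ℕ∞) ψ) (hψs : HasCompactSupport ψ) {s : ℝ} (hs : s ∈ Ioo 0 T)
    (hV : Integrable fun x => vstDensity u ω x s * ψ x)
    (hE : Integrable fun x => (∑ i : Fin 3, ω x s i * deriv (fun r => ω x r i) s) * ψ x)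
    (hG : Integrable fun x => gradSq ω x s * ψ x) :
    (∫ x, vstDensity u ω x s * ψ x)
      - (∫ x, (∑ i : Fin 3, ω x s i * deriv (fun r => ω x r i) s) * ψ x)
      - (∫ x, gradSq ω x s * ψ x)
      = -∫ x, (1 / 2) * ‖ω x s‖ ^ 2 * (∑ j, u x s j * pd j ψ x + lap ψ x) := by
  have key := fun i => integral_energy_identity (U := fun j y => u y s j)
    (contDiff_slice (hω.comp_apply i) s) hψ hψs (fun j => contDiff_slice (hu.comp_apply j) s)
    (fun x => hdiv x s hs)
  have hsum := integral_finsetSum Finset.univ fun i _ => (key i).1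
  rw [Finset.sum_eq_zero fun i _ => (key i).2] at hsum
  have hInt := integrable_finsetSum Finset.univ fun i _ => (key i).1
  have hpt : ∀ x, (1 / 2) * ‖ω x s‖ ^ 2 * (∑ j, u x s j * pd j ψ x + lap ψ x) =
      (∑ i, ((∑ j, u x s j * pd j (fun y => ω y s i) x
          - ∑ j, pd j (pd j fun y => ω y s i) x) * ω x s i * ψ x
        - (∑ j, pd j (fun y => ω y s i) x ^ 2) * ψ x
        + (1 / 2) * ω x s i ^ 2 * (∑ j, u x s j * pd j ψ x + lap ψ x)))
      - (vstDensity u ω x s * ψ x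
        - (∑ i : Fin 3, ω x s i * deriv (fun r => ω x r i) s) * ψ x
        - gradSq ω x s * ψ x) := by
    intro x
    have h := heq x s hs
    have h0 := h 0
    have h1 := h 1
    have h2 := h 2
    simp only [EuclideanSpace.real_norm_sq_eq, vstDensity, gradSq, Fin.sum_univ_three] at h0 h1 h2 ⊢
    linear_combination (-ω x s 0 * ψ x) * h0 - ω x s 1 * ψ x * h1 - ω x s 2 * ψ x * h2
  have hVE : Integrable fun x => vstDensity u ω x s * ψ x
      - (∑ i : Fin 3, ω x s i * deriv (fun r => ω x r i) s) * ψ x := hV.sub hE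
  have hVEG : Integrable fun x => vstDensity u ω x s * ψ x
      - (∑ i : Fin 3, ω x s i * deriv (fun r => ω x r i) s) * ψ x - gradSq ω x s * ψ x :=
    hVE.sub hG
  rw [(integral_congr_ae (Filter.Eventually.of_forall hpt)).trans (integral_sub hInt hVEG),
    hsum, integral_sub hVE hG, integral_sub hV hE]
  ring

/-- the localized vortex-stretching representation with error bound:
`|∫₀ᵗ∫ (ω·∇)u·ω φ − ∫ ½|ω(t)|²ψ − ∫₀ᵗ∫ |∇ω|²φ|
  ≤ ¼ ∫₀ᵗ∫ |∇ω|²φ + C max{M²,1} (1/R⁴) ∫₀ᵗ∫ |ω|²φ^{1/2}`,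
with `C` depending only on `C₀` and the Sobolev constant of `ℝ³`. -/
theorem localized_vortex_stretching_estimate (C₀ : ℝ) (hC₀ : 0 < C₀) :
    ∃ C : ℝ, 0 < C ∧
      ∀ (T : ℝ), 0 < T → T ≤ 1 →
      ∀ u ω : ℝ³ → ℝ → ℝ³,
        SmoothVF u → DivFree T u → SmoothVF ω → VorticityEq T u ω →
      ∀ (x₀ : ℝ³) (R : ℝ), 0 < R → R^2 ≤ T →
      ∀ ψ : ℝ³ → ℝ,
        IsSpatialCutoff x₀ R (3/4) C₀ ψ → IsSpatialCutoff x₀ R (7/8) C₀ ψ →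
      ∀ η : ℝ → ℝ,
        IsTemporalCutoff T (3/4) C₀ η → IsTemporalCutoff T (7/8) C₀ η →
      ∀ t ∈ Set.Ioo (2*T/3) T,
      ∀ M : ℝ,
        (∀ s ∈ Set.Ioo (0:ℝ) t, ∫ x in Metric.ball x₀ (2 * R), ‖u x s‖^2 ≤ M) →
        |(∫ s in Set.Ioo (0:ℝ) t, ∫ x : ℝ³, vstDensity u ω x s * (ψ x * η s))
            - (∫ x : ℝ³, (1/2) * ‖ω x t‖^2 * ψ x)
            - ∫ s in Set.Ioo (0:ℝ) t, ∫ x : ℝ³, gradSq ω x s * (ψ x * η s)|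
          ≤ (1/4) * (∫ s in Set.Ioo (0:ℝ) t, ∫ x : ℝ³, gradSq ω x s * (ψ x * η s))
            + C * max (M^2) 1 * (1 / R^4)
              * ∫ s in Set.Ioo (0:ℝ) t, ∫ x : ℝ³, ‖ω x s‖^2 * (ψ x * η s) ^ ((1:ℝ)/2) := by
  obtain ⟨S, hS, hflux⟩ := exists_cutoff_flux_estimate
  refine ⟨C₀ + C₀ ^ 2 + 128 ^ 3 * C₀ ^ 4 * S, by positivity, ?_⟩
  intro T hT hT1 u ω hu hdiv hω heq x₀ R hR hRT ψ hψ34 hψ78 η hη34 _ t ht M hM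
  have hcs := hψ34.hasCompactSupport
  have hψ := hψ34.1
  have hψ01 := hψ34.2.1
  obtain ⟨hη, hη01, hη0, hη1, hη'⟩ := hη34
  have ht0 : 0 < t := by linarith [ht.1]
  have hψh : Continuous fun x => ψ x ^ ((1 : ℝ) / 2) :=
    hψ.continuous.rpow_const fun x => Or.inr (by norm_num)
  have hψhs : HasCompactSupport fun x => ψ x ^ ((1 : ℝ) / 2) :=
    hcs.comp_left (g := fun r : ℝ => r ^ ((1 : ℝ) / 2)) (by norm_num)
  have hpd : ∀ {v : ℝ³ → ℝ → ℝ³}, SmoothVF v → ∀ i j,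
      Continuous fun z : ℝ³ × ℝ => pd j (fun y => v y z.2 i) z.1 := fun hv i j =>
    continuous_pd_slice (hv.comp_apply i) j
  have hωc : ∀ i, Continuous fun z : ℝ³ × ℝ => ω z.1 z.2 i := fun i => (hω.comp_apply i).continuous
  have cV : Continuous fun z : ℝ³ × ℝ => vstDensity u ω z.1 z.2 :=
    continuous_finsetSum _ fun i _ => continuous_finsetSum _ fun j _ =>
      ((hωc j).mul (hpd hu i j)).mul (hωc i)
  have cG : Continuous fun z : ℝ³ × ℝ => gradSq ω z.1 z.2 :=
    continuous_finsetSum _ fun i _ => continuous_finsetSum _ fun j _ => (hpd hω i j).pow 2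
  have cN : Continuous fun z : ℝ³ × ℝ => ‖ω z.1 z.2‖ ^ 2 := hω.continuous.norm.pow 2
  have cE : Continuous fun z : ℝ³ × ℝ => (1 / 2) * ‖ω z.1 z.2‖ ^ 2 := continuous_const.mul cN
  have cE' : Continuous fun z : ℝ³ × ℝ =>
      ∑ i : Fin 3, ω z.1 z.2 i * deriv (fun r => ω z.1 r i) z.2 :=
    continuous_finsetSum _ fun i _ => (hωc i).mul (continuous_deriv_slice (hω.comp_apply i))
  have hdE : ∀ x s, HasDerivAt (fun r => (1 / 2) * ‖ω x r‖ ^ 2)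
      (∑ i : Fin 3, ω x s i * deriv (fun r => ω x r i) s) s := by
    intro x s
    simp only [EuclideanSpace.real_norm_sq_eq]
    have h : ∀ i ∈ Finset.univ, HasDerivAt (fun r => ω x r i ^ 2)
        (2 * ω x s i * deriv (fun r => ω x r i) s) s := fun i _ => by
      simpa using (hasDerivAt_slice (hω.comp_apply i) x s).fun_pow 2
    refine ((HasDerivAt.fun_sum h).const_mul (1 / 2)).congr_deriv ?_
    rw [Finset.mul_sum]
    exact Finset.sum_congr rfl fun i _ => by ring
  set V : ℝ → ℝ := fun s => ∫ x, vstDensity u ω x s * ψ x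
  set G : ℝ → ℝ := fun s => ∫ x, gradSq ω x s * ψ x
  set E : ℝ → ℝ := fun s => ∫ x, (1 / 2) * ‖ω x s‖ ^ 2 * ψ x
  set E' : ℝ → ℝ := fun s => ∫ x, (∑ i : Fin 3, ω x s i * deriv (fun r => ω x r i) s) * ψ x
  set A : ℝ → ℝ := fun s => ∫ x, ‖ω x s‖ ^ 2 * ψ x ^ ((1 : ℝ) / 2) with hAdef
  have kV : Continuous V := continuous_integral_mul_cutoff cV hψ.continuous hcs
  have kG : Continuous G := continuous_integral_mul_cutoff cG hψ.continuous hcs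
  have kE : Continuous E :=
    continuous_integral_mul_cutoff (F := fun x s => (1 / 2) * ‖ω x s‖ ^ 2) cE hψ.continuous hcs
  have kE' : Continuous E' := continuous_integral_mul_cutoff
    (F := fun x s => ∑ i : Fin 3, ω x s i * deriv (fun r => ω x r i) s) cE' hψ.continuous hcs
  have kA : Continuous A :=
    continuous_integral_mul_cutoff (F := fun x s => ‖ω x s‖ ^ 2) cN hψh hψhs
  have kη' : Continuous (deriv η) := hη.continuous_deriv (by simp)
  have kηh : Continuous fun s => η s ^ ((1 : ℝ) / 2) :=
    hη.continuous.rpow_const fun x => Or.inr (by norm_num)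
  have dE : ∀ s, HasDerivAt E (E' s) s :=
    hasDerivAt_integral_mul_cutoff (F := fun x s => (1 / 2) * ‖ω x s‖ ^ 2) cE cE' hdE
      hψ.continuous hcs
  have hη00 : η 0 = 0 := by
    have h : (0 : ℝ) ∈ closure (Ioo 0 (T / 3)) := by
      rw [closure_Ioo (by positivity)]
      exact ⟨le_rfl, by positivity⟩
    exact closure_minimal (fun s hs => hη0 s hs) (isClosed_eq hη.continuous continuous_const) h
  have hηt : η t = 1 := hη1 t ht
  have hIoo : ∀ f : ℝ → ℝ, ∫ s in Ioo 0 t, f s = ∫ s in (0 : ℝ)..t, f s := fun f => by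
    rw [intervalIntegral.integral_of_le ht0.le, integral_Ioc_eq_integral_Ioo]
  have hInt : ∀ {f : ℝ → ℝ}, Continuous f → IntegrableOn f (Ioo 0 t) := fun hf =>
    (hf.continuousOn.integrableOn_compact (isCompact_Icc (a := 0) (b := t))).mono_set
      Ioo_subset_Icc_self
  have hFTC : E t = ∫ s in Ioo 0 t, (deriv η s * E s + η s * E' s) := by
    rw [hIoo, intervalIntegral.integral_eq_sub_of_hasDerivAt (f := fun s => η s * E s)]
    · simp [hη00, hηt]
    · exact fun s _ => ((hη.differentiable (by simp) s).hasDerivAt).mul (dE s)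
    · exact ((kη'.mul kE).add (hη.continuous.mul kE')).intervalIntegrable _ _
  have pull : ∀ (F : ℝ³ → ℝ → ℝ) s, ∫ x, F x s * (ψ x * η s) = η s * ∫ x, F x s * ψ x := by
    intro F s
    rw [← integral_const_mul]
    congr 1; ext x; ring
  have pullh : ∀ s, ∫ x, ‖ω x s‖ ^ 2 * (ψ x * η s) ^ ((1 : ℝ) / 2) =
      η s ^ ((1 : ℝ) / 2) * A s := by
    intro s
    rw [hAdef, ← integral_const_mul]
    congr 1; ext x
    rw [Real.mul_rpow (hψ01 x).1 (hη01 s).1]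
    ring
  simp only [pull, pullh]
  change |(∫ s in Ioo 0 t, η s * V s) - E t - ∫ s in Ioo 0 t, η s * G s| ≤
    1 / 4 * (∫ s in Ioo 0 t, η s * G s) + _ * ∫ s in Ioo 0 t, η s ^ ((1 : ℝ) / 2) * A s
  have iV : IntegrableOn (fun s => η s * V s) (Ioo 0 t) := hInt (hη.continuous.mul kV)
  have iG : IntegrableOn (fun s => η s * G s) (Ioo 0 t) := hInt (hη.continuous.mul kG)
  have iE : IntegrableOn (fun s => deriv η s * E s + η s * E' s) (Ioo 0 t) :=
    hInt ((kη'.mul kE).add (hη.continuous.mul kE'))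
  have iA : IntegrableOn (fun s => η s ^ ((1 : ℝ) / 2) * A s) (Ioo 0 t) := hInt (kηh.mul kA)
  have iVE : IntegrableOn (fun s => η s * V s - (deriv η s * E s + η s * E' s)) (Ioo 0 t) :=
    iV.sub iE
  rw [hFTC, ← integral_sub iV iE, ← integral_sub iVE iG, ← integral_const_mul,
    ← integral_const_mul, ← integral_add (iG.const_mul _) (iA.const_mul _), ← Real.norm_eq_abs]
  refine norm_integral_le_of_norm_le ((iG.const_mul _).add (iA.const_mul _))
    ((ae_restrict_iff' measurableSet_Ioo).2 (Filter.Eventually.of_forall fun s hs => ?_))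
  have slice : ∀ {H : ℝ³ → ℝ → ℝ}, (Continuous fun z : ℝ³ × ℝ => H z.1 z.2) →
      Continuous fun x => H x s := fun hH =>
    hH.comp (continuous_id.prodMk continuous_const : Continuous fun x : ℝ³ => (x, s))
  have islice : ∀ {H : ℝ³ → ℝ → ℝ}, (Continuous fun z : ℝ³ × ℝ => H z.1 z.2) →
      Integrable fun x => H x s * ψ x := fun hH =>
    ((slice hH).mul hψ.continuous).integrable_of_hasCompactSupport hcs.mul_left
  have hbal := integral_vstDensity_eq hu hdiv hω heq hψ hcs ⟨hs.1, hs.2.trans ht.2⟩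
    (islice cV)
    (islice (H := fun x s => ∑ i : Fin 3, ω x s i * deriv (fun r => ω x r i) s) cE') (islice cG)
  have hfl := hflux C₀ R M x₀ (fun y => ω y s) (fun y => u y s) ψ hC₀ hR
    (fun i => contDiff_slice (hω.comp_apply i) s)
    (hu.continuous.comp (by fun_prop : Continuous fun x : ℝ³ => (x, s))) hψ34 hψ78 (hM s hs)
  change V s - E' s - G s = _ at hbal
  change _ ≤ 1 / 4 * G s + _ * A s at hfl
  rw [← abs_neg, ← hbal] at hfl
  have hA0 : 0 ≤ A s := integral_nonneg fun x =>
    mul_nonneg (by positivity) (Real.rpow_nonneg (hψ01 x).1 _)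
  have hE0 : 0 ≤ E s := integral_nonneg fun x => mul_nonneg (by positivity) (hψ01 x).1
  have hEA : E s ≤ 1 / 2 * A s := by
    rw [hAdef, ← integral_const_mul]
    have hi : Integrable fun x => ‖ω x s‖ ^ 2 * ψ x ^ ((1 : ℝ) / 2) :=
      ((slice (H := fun x s => ‖ω x s‖ ^ 2) cN).mul hψh).integrable_of_hasCompactSupport
        hψhs.mul_left
    refine integral_mono (islice (H := fun x s => (1 / 2) * ‖ω x s‖ ^ 2) cE) (hi.const_mul _)
      fun x => ?_
    have hle : ψ x ≤ ψ x ^ ((1 : ℝ) / 2) :=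
      Real.self_le_rpow_of_le_one (hψ01 x).1 (hψ01 x).2 (by norm_num)
    calc (1 / 2) * ‖ω x s‖ ^ 2 * ψ x ≤ (1 / 2) * ‖ω x s‖ ^ 2 * ψ x ^ ((1 : ℝ) / 2) := by gcongr
      _ = _ := by ring
  have hη0s := (hη01 s).1
  have hηle : η s ≤ η s ^ ((1 : ℝ) / 2) :=
    Real.self_le_rpow_of_le_one hη0s (hη01 s).2 (by norm_num)
  have hη'le : |deriv η s| ≤ C₀ / R ^ 2 * η s ^ ((1 : ℝ) / 2) := by
    refine (hη' s).trans ?_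
    gcongr ?_ * ?_
    · gcongr
    · exact Real.rpow_le_rpow_of_exponent_ge' hη0s (hη01 s).2 (by norm_num) (by norm_num)
  have hh0 : 0 ≤ η s ^ ((1 : ℝ) / 2) := Real.rpow_nonneg hη0s _
  generalize η s ^ ((1 : ℝ) / 2) = h at *
  have hconst : (C₀ / R) ^ 2 / 16 + 128 ^ 3 * (C₀ / R / 2) ^ 4 * M ^ 2 * S + C₀ / R ^ 2 / 2
      + C₀ / R ^ 2 / 2 ≤ (C₀ + C₀ ^ 2 + 128 ^ 3 * C₀ ^ 4 * S) * max (M ^ 2) 1 * (1 / R ^ 4) := by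
    have hR2 : R ^ 2 ≤ 1 := hRT.trans hT1
    have hm1 : 1 ≤ max (M ^ 2) 1 := le_max_right _ _
    have hmM : M ^ 2 ≤ max (M ^ 2) 1 := le_max_left _ _
    generalize max (M ^ 2) 1 = m at *
    have e : (C₀ / R) ^ 2 / 16 + 128 ^ 3 * (C₀ / R / 2) ^ 4 * M ^ 2 * S + C₀ / R ^ 2 / 2
        + C₀ / R ^ 2 / 2 = (C₀ ^ 2 / 16 * R ^ 2 + 128 ^ 3 * C₀ ^ 4 / 16 * M ^ 2 * S + C₀ * R ^ 2)
          * (1 / R ^ 4) := by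
      field_simp
      ring
    rw [e]
    gcongr
    have hR2m : R ^ 2 ≤ m := hR2.trans hm1
    calc _ ≤ C₀ ^ 2 / 16 * m + 128 ^ 3 * C₀ ^ 4 / 16 * m * S + C₀ * m := by gcongr
      _ ≤ _ := by
        have h1 : 0 ≤ C₀ ^ 2 * m := by positivity
        have h2 : 0 ≤ C₀ ^ 4 * m * S := by positivity
        nlinarith
  set K := (C₀ / R) ^ 2 / 16 + 128 ^ 3 * (C₀ / R / 2) ^ 4 * M ^ 2 * S + C₀ / R ^ 2 / 2
  have hK0 : 0 ≤ K := by positivity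
  calc ‖η s * V s - (deriv η s * E s + η s * E' s) - η s * G s‖
      = |η s * (V s - E' s - G s) - deriv η s * E s| := by
        rw [Real.norm_eq_abs]; congr 1; ring
    _ ≤ η s * |V s - E' s - G s| + |deriv η s| * E s := by
        refine (abs_sub _ _).trans ?_
        rw [abs_mul, abs_mul, abs_of_nonneg hη0s, abs_of_nonneg hE0]
    _ ≤ η s * (1 / 4 * G s + K * A s) + C₀ / R ^ 2 * h * (1 / 2 * A s) := by
        gcongr
    _ = 1 / 4 * (η s * G s) + (η s * (K * A s) + C₀ / R ^ 2 / 2 * (h * A s)) := by ring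
    _ ≤ 1 / 4 * (η s * G s) + (h * (K * A s) + C₀ / R ^ 2 / 2 * (h * A s)) := by gcongr
    _ = 1 / 4 * (η s * G s) + (K + C₀ / R ^ 2 / 2) * (h * A s) := by ring
    _ ≤ _ := by gcongr
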